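/- Let k be a positive integer and let 2 ≤ h ≤ k. Assume that for every η > 0 there exists a positive integer n_0(η) such that R_{(ℤ+)^k,h}(n) < n^η for every n ≥ n_0(η). Then for every ε > 0 there exist a set A ⊆ (ℤ+)^k and constants C > 0 and c > 0 such that R_{A,h}(n) ≤ C for every positive integer n and A(x) ≥ c·x^{1/k − ε} for all sufficiently large x. -/

import Mathlib

/-- The set of k-th powers of positive integers. -/
def kPow (k : ℕ) : Set ℕ := {m | ∃ j : ℕ, 1 ≤ j ∧ m = j ^ k}

/-- `Rcnt A l n` : number of representations `n = a_1 + ... + a_l` with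
`a_1 < a_2 < ... < a_l`, all terms in `A`. -/
noncomputable def Rcnt (A : Set ℕ) (l n : ℕ) : ℕ :=
  {f : Fin l → ℕ | StrictMono f ∧ (∀ i, f i ∈ A) ∧ ∑ i, f i = n}.ncard

/-- `countBelow A x` : the counting function `A(x) = #{a ∈ A : a ≤ x}`. -/
noncomputable def countBelow (A : Set ℕ) (x : ℝ) : ℕ :=
  {a ∈ A | (a : ℝ) ≤ x}.ncard

open MeasureTheory Filter
open scoped ENNReal Finset

/-- The law of an infinite sequence of independent choices, the `i`-th one uniform in `Fin (d i)`. -/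
noncomputable def uniformChoice (d : ℕ → ℕ) [∀ i, NeZero (d i)] : Measure (∀ i, Fin (d i)) :=
  Measure.infinitePi fun i => (PMF.uniformOfFintype (Fin (d i))).toMeasure

instance (d : ℕ → ℕ) [∀ i, NeZero (d i)] : IsProbabilityMeasure (uniformChoice d) := by
  unfold uniformChoice; infer_instance

theorem uniformChoice_subset_range_le {d : ℕ → ℕ} [∀ i, NeZero (d i)]
    {e : ∀ i, Fin (d i) → ℕ} (he : ∀ i j r s, e i r = e j s → i = j ∧ (r : ℕ) = s)
    (T : Finset ℕ) (p : ℝ≥0∞) (hp : ∀ i r, e i r ∈ T → (d i : ℝ≥0∞)⁻¹ ≤ p) :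
    uniformChoice d {ω | (T : Set ℕ) ⊆ Set.range fun i => e i (ω i)} ≤ p ^ #T := by
  rcases Set.eq_empty_or_nonempty {ω : ∀ i, Fin (d i) | (T : Set ℕ) ⊆ Set.range fun i => e i (ω i)}
    with h | ⟨ω₀, hω₀⟩
  · simp [h]
  have hinj : Function.Injective fun i => e i (ω₀ i) := fun i j hij => (he _ _ _ _ hij).1
  set S := T.preimage (fun i => e i (ω₀ i)) hinj.injOn
  have hcard : #S = #T := by
    rw [← Finset.card_image_of_injective S hinj, Finset.image_preimage_of_bij]
    exact ⟨fun x hx => hx, hinj.injOn, fun a ha => by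
      obtain ⟨i, hi⟩ := hω₀ ha
      exact ⟨i, by simpa [hi] using ha, hi⟩⟩
  calc uniformChoice d {ω | (T : Set ℕ) ⊆ Set.range fun i => e i (ω i)}
      ≤ uniformChoice d (Set.pi S fun i => {ω₀ i}) := by
        refine measure_mono fun ω hω i hi => ?_
        obtain ⟨j, hj⟩ := hω (Finset.mem_preimage.1 hi)
        obtain ⟨rfl, h⟩ := he _ _ _ _ hj
        exact Fin.ext h
    _ = ∏ i ∈ S, (d i : ℝ≥0∞)⁻¹ := by
        rw [uniformChoice, Measure.infinitePi_pi _ fun _ _ => measurableSet_singleton _]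
        simp
    _ ≤ ∏ _i ∈ S, p := Finset.prod_le_prod' fun i hi =>
        hp i (ω₀ i) ((Finset.mem_preimage (f := fun i => e i (ω₀ i))).1 hi)
    _ = p ^ #T := by simp [hcard]

theorem uniformChoice_le_card_inter_range_le {d : ℕ → ℕ} [∀ i, NeZero (d i)]
    {e : ∀ i, Fin (d i) → ℕ} (he : ∀ i j r s, e i r = e j s → i = j ∧ (r : ℕ) = s)
    (M : Finset ℕ) (p : ℝ≥0∞) (hp : ∀ i r, e i r ∈ M → (d i : ℝ≥0∞)⁻¹ ≤ p) (t : ℕ) :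
    uniformChoice d {ω | t ≤ ((M : Set ℕ) ∩ Set.range fun i => e i (ω i)).ncard} ≤
      (#M * p) ^ t := by
  calc uniformChoice d {ω | t ≤ ((M : Set ℕ) ∩ Set.range fun i => e i (ω i)).ncard}
      ≤ uniformChoice d (⋃ T ∈ M.powersetCard t,
          {ω | (T : Set ℕ) ⊆ Set.range fun i => e i (ω i)}) := by
        refine measure_mono fun ω hω => ?_
        obtain ⟨T, hT, hTt⟩ := Set.exists_subset_card_eq (show t ≤ _ from hω)
        have hfin : T.Finite := M.finite_toSet.subset (hT.trans Set.inter_subset_left)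
        lift T to Finset ℕ using hfin
        rw [Set.ncard_coe_finset] at hTt
        simp only [Set.mem_iUnion, Finset.mem_powersetCard]
        exact ⟨T, ⟨by exact_mod_cast hT.trans Set.inter_subset_left, hTt⟩,
          hT.trans Set.inter_subset_right⟩
    _ ≤ ∑ T ∈ M.powersetCard t, p ^ t := by
        refine (measure_biUnion_finset_le _ _).trans (Finset.sum_le_sum fun T hT => ?_)
        obtain ⟨hTM, hTt⟩ := Finset.mem_powersetCard.1 hT
        exact hTt ▸ uniformChoice_subset_range_le he T p fun i r h => hp i r (hTM h)
    _ ≤ (#M * p) ^ t := by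
        rw [Finset.sum_const, Finset.card_powersetCard, nsmul_eq_mul, mul_pow]
        gcongr
        exact_mod_cast Nat.choose_le_pow _ _

theorem ae_exists_card_inter_range_le {d : ℕ → ℕ} [∀ i, NeZero (d i)]
    {e : ∀ i, Fin (d i) → ℕ} (he : ∀ i j r s, e i r = e j s → i = j ∧ (r : ℕ) = s)
    (M : ℕ → Finset ℕ) (p : ℕ → ℝ≥0∞) (hp : ∀ m i r, e i r ∈ M m → (d i : ℝ≥0∞)⁻¹ ≤ p m) (t : ℕ)
    (hsum : ∑' m, (#(M m) * p m) ^ t ≠ ∞) :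
    ∀ᵐ ω ∂uniformChoice d,
      ∃ B : ℕ, ∀ m, ((M m : Set ℕ) ∩ Set.range fun i => e i (ω i)).ncard ≤ B := by
  have hfin : uniformChoice d {ω | ∃ᶠ m in atTop,
      t ≤ ((M m : Set ℕ) ∩ Set.range fun i => e i (ω i)).ncard} = 0 := by
    refine measure_setOfPred_frequently_eq_zero (ne_top_of_le_ne_top hsum ?_)
    exact ENNReal.tsum_le_tsum fun m => uniformChoice_le_card_inter_range_le he _ _ (hp m) t
  have hae : ∀ᵐ ω ∂uniformChoice d, ∀ᶠ m in atTop,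
      ((M m : Set ℕ) ∩ Set.range fun i => e i (ω i)).ncard < t := by
    rw [ae_iff]
    simpa [Filter.Frequently] using hfin
  filter_upwards [hae] with ω hω
  obtain ⟨m₀, hm₀⟩ := eventually_atTop.1 hω
  refine ⟨t + ∑ m ∈ Finset.range m₀, #(M m), fun m => ?_⟩
  rcases le_or_gt m₀ m with h | h
  · exact (hm₀ m h).le.trans (Nat.le_add_right _ _)
  · calc ((M m : Set ℕ) ∩ Set.range fun i => e i (ω i)).ncard ≤ #(M m) := by
          rw [← Set.ncard_coe_finset]
          exact Set.ncard_le_ncard Set.inter_subset_left (M m).finite_toSet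
      _ ≤ ∑ m ∈ Finset.range m₀, #(M m) :=
          Finset.single_le_sum (f := fun m => #(M m)) (fun _ _ => Nat.zero_le _)
            (Finset.mem_range.2 h)
      _ ≤ _ := Nat.le_add_left _ _

/-- The strictly increasing representations of `n` as a sum of `l` elements of `A`. -/
def increasingReps (A : Set ℕ) (l n : ℕ) : Set (Fin l → ℕ) :=
  {f | StrictMono f ∧ (∀ i, f i ∈ A) ∧ ∑ i, f i = n}

/-- The largest terms of the representations of `n` as a sum of `l + 1` elements of `A`. -/
def maxTerms (A : Set ℕ) (l n : ℕ) : Set ℕ :=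
  (fun f => f (Fin.last l)) '' increasingReps A (l + 1) n

theorem apply_le_of_mem_increasingReps {A : Set ℕ} {l n : ℕ} {f : Fin l → ℕ}
    (hf : f ∈ increasingReps A l n) (i : Fin l) : f i ≤ n :=
  hf.2.2 ▸ Finset.single_le_sum (f := f) (fun _ _ => Nat.zero_le _) (Finset.mem_univ i)

theorem finite_increasingReps (A : Set ℕ) (l n : ℕ) : (increasingReps A l n).Finite :=
  (Set.finite_Iic fun _ => n).subset fun _ hf i => apply_le_of_mem_increasingReps hf i

theorem finite_maxTerms (A : Set ℕ) (l n : ℕ) : (maxTerms A l n).Finite :=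
  (finite_increasingReps A (l + 1) n).image _

theorem ncard_maxTerms_le (A : Set ℕ) (l n : ℕ) : (maxTerms A l n).ncard ≤ Rcnt A (l + 1) n :=
  Set.ncard_image_le (finite_increasingReps A (l + 1) n)

theorem le_mul_of_mem_maxTerms {A : Set ℕ} {l n a : ℕ} (ha : a ∈ maxTerms A l n) :
    n ≤ (l + 1) * a := by
  obtain ⟨f, hf, rfl⟩ := ha
  calc n = ∑ i, f i := hf.2.2.symm
    _ ≤ ∑ _i : Fin (l + 1), f (Fin.last l) :=
        Finset.sum_le_sum fun i _ => hf.1.monotone (Fin.le_last i)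
    _ = _ := by simp

theorem init_mem_increasingReps {A : Set ℕ} {l n : ℕ} {f : Fin (l + 1) → ℕ}
    (hf : f ∈ increasingReps A (l + 1) n) : Fin.init f ∈ increasingReps A l (n - f (Fin.last l)) := by
  obtain ⟨hmono, hA, hsum⟩ := hf
  refine ⟨hmono.comp Fin.strictMono_castSucc, fun i => hA _, ?_⟩
  rw [Fin.sum_univ_castSucc] at hsum
  simp only [Fin.init]
  omega

theorem Rcnt_succ_le_of_maxTerms {A Q : Set ℕ} (hAQ : A ⊆ Q) {l B C : ℕ}
    (hB : ∀ n, (maxTerms Q l n ∩ A).ncard ≤ B) (hC : ∀ n, Rcnt A l n ≤ C) (n : ℕ) :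
    Rcnt A (l + 1) n ≤ B * C := by
  have hfin : (maxTerms Q l n ∩ A).Finite := (finite_maxTerms Q l n).inter_of_left A
  have hsub : increasingReps A (l + 1) n ⊆ ⋃ a ∈ hfin.toFinset,
      (fun g => (Fin.snoc g a : Fin (l + 1) → ℕ)) '' increasingReps A l (n - a) := by
    intro f hf
    simp only [Set.mem_iUnion, Set.Finite.mem_toFinset]
    exact ⟨f (Fin.last l), ⟨⟨f, ⟨hf.1, fun i => hAQ (hf.2.1 i), hf.2.2⟩, rfl⟩, hf.2.1 _⟩,
      Fin.init f, init_mem_increasingReps hf, Fin.snoc_init_self f⟩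
  calc Rcnt A (l + 1) n
      ≤ (⋃ a ∈ hfin.toFinset,
          (fun g => (Fin.snoc g a : Fin (l + 1) → ℕ)) '' increasingReps A l (n - a)).ncard :=
        Set.ncard_le_ncard hsub
          (hfin.toFinset.finite_toSet.biUnion fun a _ => (finite_increasingReps A l _).image _)
    _ ≤ ∑ a ∈ hfin.toFinset,
          ((fun g => (Fin.snoc g a : Fin (l + 1) → ℕ)) '' increasingReps A l (n - a)).ncard :=
        Finset.set_ncard_biUnion_le _ _
    _ ≤ ∑ _a ∈ hfin.toFinset, C :=
        Finset.sum_le_sum fun a _ => (Set.ncard_image_le (finite_increasingReps A l _)).trans (hC _)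
    _ ≤ B * C := by
        rw [Finset.sum_const, smul_eq_mul, ← Set.ncard_eq_toFinset_card _ hfin]
        exact Nat.mul_le_mul_right _ (hB n)

theorem exists_Rcnt_le_of_maxTerms {A Q : Set ℕ} (hAQ : A ⊆ Q) {h : ℕ}
    (hB : ∀ l < h, ∃ B : ℕ, ∀ n, (maxTerms Q l n ∩ A).ncard ≤ B) :
    ∃ C : ℕ, ∀ n, Rcnt A h n ≤ C := by
  induction h with
  | zero => exact ⟨1, fun n => Set.ncard_le_one_of_subsingleton _⟩
  | succ l ih =>
    obtain ⟨C, hC⟩ := ih fun j hj => hB j (hj.trans l.lt_succ_self)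
    obtain ⟨B, hB⟩ := hB l l.lt_succ_self
    exact ⟨B * C, Rcnt_succ_le_of_maxTerms hAQ hB hC⟩

theorem Rcnt_le_Rcnt_succ {A : Set ℕ} {l n a : ℕ} (ha : a ∈ A) (hna : n < a) :
    Rcnt A l n ≤ Rcnt A (l + 1) (n + a) := by
  refine Set.ncard_le_ncard_of_injOn (fun f => (Fin.snoc f a : Fin (l + 1) → ℕ)) ?_ ?_
    (finite_increasingReps A (l + 1) (n + a))
  · intro f hf
    have hle := apply_le_of_mem_increasingReps hf
    obtain ⟨hmono, hA, hsum⟩ := hf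
    refine ⟨?_, fun i => ?_, by simp [Fin.sum_univ_castSucc, hsum]⟩
    · intro i j hij
      induction j using Fin.lastCases with
      | last =>
        induction i using Fin.lastCases with
        | last => exact absurd hij (lt_irrefl _)
        | cast i => simpa using (hle i).trans_lt hna
      | cast j =>
        induction i using Fin.lastCases with
        | last => exact absurd (hij.trans (Fin.castSucc_lt_last j)) (lt_irrefl _)
        | cast i => simpa using hmono (by simpa using hij)
    · induction i using Fin.lastCases with
      | last => simpa using ha
      | cast i => simpa using hA i
  · intro f _ g _ hfg
    exact (Fin.snoc_injective2 hfg).1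

/-- `A` has subpolynomially many representations of `n` as a sum of `l` increasing terms. -/
def SubpolyRcnt (A : Set ℕ) (l : ℕ) : Prop :=
  ∀ η : ℝ, 0 < η → ∃ C : ℝ, ∀ n : ℕ, 1 ≤ n → (Rcnt A l n : ℝ) ≤ C * (n : ℝ) ^ η

theorem SubpolyRcnt.of_eventually {A : Set ℕ} {l : ℕ}
    (hA : ∀ η : ℝ, 0 < η → ∃ n0 : ℕ, 1 ≤ n0 ∧ ∀ n : ℕ, n0 ≤ n → (Rcnt A l n : ℝ) < (n : ℝ) ^ η) :
    SubpolyRcnt A l := by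
  intro η hη
  obtain ⟨n₀, -, hn₀⟩ := hA η hη
  refine ⟨1 + ∑ m ∈ Finset.range n₀, (Rcnt A l m : ℝ), fun n hn => ?_⟩
  have hsum : 0 ≤ ∑ m ∈ Finset.range n₀, (Rcnt A l m : ℝ) :=
    Finset.sum_nonneg fun _ _ => Nat.cast_nonneg _
  have hpow : 1 ≤ (n : ℝ) ^ η := Real.one_le_rpow (by exact_mod_cast hn) hη.le
  rcases le_or_gt n₀ n with h | h
  · nlinarith [hn₀ n h]
  · have := Finset.single_le_sum (f := fun m => (Rcnt A l m : ℝ)) (fun _ _ => Nat.cast_nonneg _)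
      (Finset.mem_range.2 h)
    nlinarith

theorem SubpolyRcnt.of_succ {k l : ℕ} (hk : 1 ≤ k) (hl : SubpolyRcnt (kPow k) (l + 1)) :
    SubpolyRcnt (kPow k) l := by
  intro η hη
  have hk0 : (0 : ℝ) < k := by exact_mod_cast hk
  obtain ⟨C, hC⟩ := hl (η / k) (by positivity)
  refine ⟨C * ((2 : ℝ) ^ (k + 1)) ^ (η / k), fun n hn => ?_⟩
  have hlt : n < (n + 1) ^ k := n.lt_succ_self.trans_le (Nat.le_self_pow (by omega) _)
  have hle : n + (n + 1) ^ k ≤ 2 ^ (k + 1) * n ^ k := by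
    have : (n + 1) ^ k ≤ 2 ^ k * n ^ k := by
      rw [← mul_pow]; exact Nat.pow_le_pow_left (by omega) k
    rw [pow_succ]; linarith
  have hC0 : 0 ≤ C := by simpa using (Nat.cast_nonneg _).trans (hC 1 le_rfl)
  calc (Rcnt (kPow k) l n : ℝ) ≤ Rcnt (kPow k) (l + 1) (n + (n + 1) ^ k) := by
        exact_mod_cast Rcnt_le_Rcnt_succ (A := kPow k) ⟨n + 1, by omega, rfl⟩ hlt
    _ ≤ C * ((n + (n + 1) ^ k : ℕ) : ℝ) ^ (η / k) := hC _ (by omega)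
    _ ≤ C * ((2 : ℝ) ^ (k + 1) * (n : ℝ) ^ k) ^ (η / k) := by
        gcongr
        exact_mod_cast hle
    _ = C * ((2 : ℝ) ^ (k + 1)) ^ (η / k) * (n : ℝ) ^ η := by
        rw [Real.mul_rpow (by positivity) (by positivity), ← Real.rpow_natCast (n : ℝ) k,
          ← Real.rpow_mul (by positivity), mul_div_cancel₀ η hk0.ne', mul_assoc]

theorem SubpolyRcnt.of_le {k l h : ℕ} (hk : 1 ≤ k) (hlh : l ≤ h) (hh : SubpolyRcnt (kPow k) h) :
    SubpolyRcnt (kPow k) l := by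
  induction hlh with
  | refl => exact hh
  | step _ ih => exact ih (hh.of_succ hk)

theorem maxTerms_kPow_zero (k l : ℕ) : maxTerms (kPow k) l 0 = ∅ := by
  refine Set.eq_empty_of_forall_notMem fun a ha => ?_
  obtain ⟨f, hf, rfl⟩ := ha
  obtain ⟨j, hj, hfj⟩ := hf.2.1 (Fin.last l)
  have := apply_le_of_mem_increasingReps hf (Fin.last l)
  have : 0 < j ^ k := by positivity
  omega

/-- The number of candidates in the `i`-th block. -/
noncomputable def blockLength (δ : ℝ) (i : ℕ) : ℕ := ⌈((i : ℝ) + 1) ^ δ⌉₊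

theorem rpow_le_blockLength (δ : ℝ) (i : ℕ) : ((i : ℝ) + 1) ^ δ ≤ blockLength δ i :=
  Nat.le_ceil _

theorem blockLength_pos (δ : ℝ) (i : ℕ) : 0 < blockLength δ i :=
  Nat.ceil_pos.2 (by positivity)

instance (δ : ℝ) (i : ℕ) : NeZero (blockLength δ i) := ⟨(blockLength_pos δ i).ne'⟩

theorem blockLength_mono {δ : ℝ} (hδ : 0 ≤ δ) : Monotone (blockLength δ) := fun i j hij => by
  unfold blockLength
  gcongr

/-- The `k`-th powers of the integers of the `i`-th block
`[(i + 1) * blockLength δ i, (i + 2) * blockLength δ i)`. -/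
noncomputable def blockPow (δ : ℝ) (k i : ℕ) (r : Fin (blockLength δ i)) : ℕ :=
  ((i + 1) * blockLength δ i + r) ^ k

theorem blockPow_mem_kPow (δ : ℝ) (k i : ℕ) (r : Fin (blockLength δ i)) :
    blockPow δ k i r ∈ kPow k :=
  ⟨_, Nat.le_add_right_of_le (Nat.mul_pos i.succ_pos (blockLength_pos δ i)), rfl⟩

theorem block_lt_block {δ : ℝ} (hδ : 0 ≤ δ) {i j : ℕ} (hij : i < j) (r : Fin (blockLength δ i))
    (s : Fin (blockLength δ j)) :
    (i + 1) * blockLength δ i + r < (j + 1) * blockLength δ j + s :=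
  calc (i + 1) * blockLength δ i + r < (i + 1) * blockLength δ i + blockLength δ i := by
        gcongr; exact r.2
    _ = (i + 1 + 1) * blockLength δ i := by ring
    _ ≤ (j + 1) * blockLength δ j := Nat.mul_le_mul (by omega) (blockLength_mono hδ hij.le)
    _ ≤ _ := Nat.le_add_right _ _

theorem blockPow_inj {δ : ℝ} (hδ : 0 ≤ δ) {k : ℕ} (hk : k ≠ 0) (i j : ℕ)
    (r : Fin (blockLength δ i)) (s : Fin (blockLength δ j))
    (h : blockPow δ k i r = blockPow δ k j s) : i = j ∧ (r : ℕ) = s := by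
  have h' : (i + 1) * blockLength δ i + r = (j + 1) * blockLength δ j + s :=
    Nat.pow_left_injective hk h
  rcases lt_trichotomy i j with hij | rfl | hij
  · exact absurd h' (block_lt_block hδ hij r s).ne
  · exact ⟨rfl, by omega⟩
  · exact absurd h' (block_lt_block hδ hij s r).ne'

theorem blockPow_le {δ : ℝ} (hδ : 0 ≤ δ) (k i : ℕ) (r : Fin (blockLength δ i)) :
    (blockPow δ k i r : ℝ) ≤ 4 ^ k * ((i : ℝ) + 1) ^ (k * (1 + δ)) := by
  have hy : (1 : ℝ) ≤ (i : ℝ) + 1 := by simp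
  have hpow : (1 : ℝ) ≤ ((i : ℝ) + 1) ^ δ := Real.one_le_rpow hy hδ
  have hlen : (blockLength δ i : ℝ) ≤ 2 * ((i : ℝ) + 1) ^ δ := by
    have := (Nat.ceil_lt_add_one (by positivity : 0 ≤ ((i : ℝ) + 1) ^ δ)).le
    unfold blockLength
    linarith
  have hr : (r : ℝ) ≤ blockLength δ i := by exact_mod_cast r.2.le
  have hbase : ((i : ℝ) + 1) * blockLength δ i + r ≤ 4 * ((i : ℝ) + 1) ^ (1 + δ) := by
    rw [Real.rpow_add (by positivity), Real.rpow_one]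
    nlinarith
  calc (blockPow δ k i r : ℝ) = (((i : ℝ) + 1) * blockLength δ i + r) ^ k := by
        simp [blockPow]
    _ ≤ (4 * ((i : ℝ) + 1) ^ (1 + δ)) ^ k := by gcongr
    _ = _ := by
        rw [mul_pow, ← Real.rpow_natCast (((i : ℝ) + 1) ^ (1 + δ)) k,
          ← Real.rpow_mul (by positivity), mul_comm (1 + δ)]

theorem inv_blockLength_le {δ : ℝ} (hδ : 0 < δ) {k : ℕ} (hk : k ≠ 0) {h m i : ℕ} (hm : 0 < m)
    (r : Fin (blockLength δ i)) (hmr : m ≤ h * blockPow δ k i r) :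
    (blockLength δ i : ℝ)⁻¹ ≤
      (h * 4 ^ k : ℝ) ^ (δ / (k * (1 + δ))) * (m : ℝ) ^ (-(δ / (k * (1 + δ)))) := by
  set β := δ / (k * (1 + δ)) with hβ
  have hk0 : (0 : ℝ) < k := by exact_mod_cast Nat.pos_of_ne_zero hk
  have hm0 : (0 : ℝ) < m := by exact_mod_cast hm
  have hlen : (0 : ℝ) < blockLength δ i := by exact_mod_cast blockLength_pos δ i
  have hmβ : (m : ℝ) ^ β ≤ (h * 4 ^ k : ℝ) ^ β * blockLength δ i :=
    calc (m : ℝ) ^ β ≤ (h * 4 ^ k * ((i : ℝ) + 1) ^ (k * (1 + δ)) : ℝ) ^ β := by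
          gcongr
          calc (m : ℝ) ≤ h * blockPow δ k i r := by exact_mod_cast hmr
            _ ≤ h * (4 ^ k * ((i : ℝ) + 1) ^ (k * (1 + δ))) := by
                gcongr; exact blockPow_le hδ.le k i r
            _ = _ := by ring
      _ = (h * 4 ^ k : ℝ) ^ β * ((i : ℝ) + 1) ^ δ := by
          rw [Real.mul_rpow (by positivity) (by positivity), ← Real.rpow_mul (by positivity), hβ,
            mul_div_cancel₀ δ (by positivity)]
      _ ≤ _ := by gcongr; exact rpow_le_blockLength δ i
  rw [Real.rpow_neg hm0.le, ← div_eq_mul_inv, inv_le_iff_one_le_mul₀ hlen, div_mul_eq_mul_div,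
    one_le_div (by positivity)]
  exact hmβ

theorem le_countBelow_range_blockPow {δ : ℝ} (hδ : 0 ≤ δ) {k : ℕ} (hk : k ≠ 0)
    (ω : ∀ i, Fin (blockLength δ i)) {x : ℝ} (hx : 4 ^ k ≤ x) :
    (x / 4 ^ k) ^ (1 / (k * (1 + δ))) / 2 ≤
      (countBelow (Set.range fun i => blockPow δ k i (ω i)) x : ℝ) := by
  have hk0 : (0 : ℝ) < k := by exact_mod_cast Nat.pos_of_ne_zero hk
  have hx1 : 1 ≤ x / 4 ^ k := (one_le_div (by positivity)).2 hx
  set y := (x / 4 ^ k) ^ (1 / (k * (1 + δ))) with hy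
  have hy1 : 1 ≤ y := Real.one_le_rpow hx1 (by positivity)
  have hfin : {a ∈ Set.range fun i => blockPow δ k i (ω i) | (a : ℝ) ≤ x}.Finite :=
    (Set.finite_Iic ⌊x⌋₊).subset fun a ha => Nat.le_floor ha.2
  have hcard : ⌊y⌋₊ ≤ countBelow (Set.range fun i => blockPow δ k i (ω i)) x := by
    rw [← Finset.card_range ⌊y⌋₊, ← Set.ncard_coe_finset]
    refine Set.ncard_le_ncard_of_injOn (fun i => blockPow δ k i (ω i)) (fun i hi => ⟨⟨i, rfl⟩, ?_⟩)
      (fun i _ j _ hij => (blockPow_inj hδ hk i j _ _ hij).1) hfin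
    have hiy : (i : ℝ) + 1 ≤ y := by
      have : i + 1 ≤ ⌊y⌋₊ := Finset.mem_range.1 hi
      exact_mod_cast (Nat.le_floor_iff (by positivity)).1 this
    calc (blockPow δ k i (ω i) : ℝ) ≤ 4 ^ k * ((i : ℝ) + 1) ^ (k * (1 + δ)) :=
          blockPow_le hδ k i _
      _ ≤ 4 ^ k * y ^ (k * (1 + δ)) := by gcongr
      _ = x := by
          rw [hy, ← Real.rpow_mul (by positivity), one_div_mul_cancel (by positivity),
            Real.rpow_one, mul_div_cancel₀ x (by positivity)]
  have hfloor : y / 2 ≤ ⌊y⌋₊ := by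
    have h1 := Nat.lt_floor_add_one y
    have h2 : (1 : ℝ) ≤ ⌊y⌋₊ := by exact_mod_cast (Nat.one_le_floor_iff y).2 hy1
    linarith
  exact hfloor.trans (by exact_mod_cast hcard)

theorem tsum_pow_card_maxTerms_mul_ne_top {k l : ℕ} (hl : SubpolyRcnt (kPow k) (l + 1))
    {β K : ℝ} (hβ : 0 < β) (hK : 0 ≤ K) :
    ∃ t : ℕ, ∑' m : ℕ, (#(finite_maxTerms (kPow k) l m).toFinset *
      ENNReal.ofReal (K * (m : ℝ) ^ (-β))) ^ t ≠ ∞ := by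
  obtain ⟨C, hC⟩ := hl (β / 2) (by positivity)
  have hC0 : 0 ≤ C := by simpa using (Nat.cast_nonneg _).trans (hC 1 le_rfl)
  set t := ⌈4 / β⌉₊
  have ht : 4 ≤ t * β := (div_le_iff₀ hβ).1 (Nat.le_ceil _)
  have ht0 : t ≠ 0 := by rintro h; simp [h] at ht; linarith
  refine ⟨t, ?_⟩
  have hsum : Summable fun m : ℕ => (C * K) ^ t * (m : ℝ) ^ (-(t * β) / 2) :=
    (Real.summable_nat_rpow.2 (by linarith)).mul_left _
  refine ne_top_of_le_ne_top hsum.tsum_ofReal_ne_top (ENNReal.tsum_le_tsum fun m => ?_)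
  rcases Nat.eq_zero_or_pos m with rfl | hm
  · simp [maxTerms_kPow_zero, ht0]
  have hm0 : (0 : ℝ) < m := by exact_mod_cast hm
  rw [← ENNReal.ofReal_natCast, ← ENNReal.ofReal_mul (by positivity),
    ← ENNReal.ofReal_pow (by positivity)]
  refine ENNReal.ofReal_le_ofReal ?_
  have hcard : (#(finite_maxTerms (kPow k) l m).toFinset : ℝ) ≤ C * (m : ℝ) ^ (β / 2) := by
    rw [← Set.ncard_eq_toFinset_card _ (finite_maxTerms (kPow k) l m)]
    exact le_trans (by exact_mod_cast ncard_maxTerms_le _ l m) (hC m hm)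
  calc (#(finite_maxTerms (kPow k) l m).toFinset * (K * (m : ℝ) ^ (-β))) ^ t
      ≤ (C * (m : ℝ) ^ (β / 2) * (K * (m : ℝ) ^ (-β))) ^ t := by gcongr
    _ = (C * K * (m : ℝ) ^ (-β / 2)) ^ t := by
        rw [show -β / 2 = β / 2 + -β by ring, Real.rpow_add hm0]; ring
    _ = (C * K) ^ t * (m : ℝ) ^ (-(t * β) / 2) := by
        rw [mul_pow, ← Real.rpow_natCast ((m : ℝ) ^ (-β / 2)) t, ← Real.rpow_mul hm0.le]
        congr 2; ring

theorem exists_choice_card_maxTerms_inter_le {δ : ℝ} (hδ : 0 < δ) {k h : ℕ} (hk : k ≠ 0)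
    (hh : SubpolyRcnt (kPow k) h) :
    ∃ ω : ∀ i, Fin (blockLength δ i), ∀ l < h, ∃ B : ℕ, ∀ m,
      (maxTerms (kPow k) l m ∩ Set.range fun i => blockPow δ k i (ω i)).ncard ≤ B := by
  have hk0 : (0 : ℝ) < k := by exact_mod_cast Nat.pos_of_ne_zero hk
  set β := δ / (k * (1 + δ)) with hβ
  set K := (h * 4 ^ k : ℝ) ^ β
  have hae : ∀ᵐ ω ∂uniformChoice (blockLength δ), ∀ l : Fin h, ∃ B : ℕ, ∀ m,
      (maxTerms (kPow k) l m ∩ Set.range fun i => blockPow δ k i (ω i)).ncard ≤ B := by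
    refine ae_all_iff.2 fun l => ?_
    obtain ⟨t, ht⟩ := tsum_pow_card_maxTerms_mul_ne_top (β := β) (K := K)
      (hh.of_le (Nat.one_le_iff_ne_zero.2 hk) l.2) (by positivity) (by positivity)
    have := ae_exists_card_inter_range_le (blockPow_inj hδ.le hk)
      (fun m => (finite_maxTerms (kPow k) l m).toFinset)
      (fun m => ENNReal.ofReal (K * (m : ℝ) ^ (-β))) (fun m i r hir => ?_) t ht
    · simpa using this
    rw [Set.Finite.mem_toFinset] at hir
    have hm : 0 < m := by
      rcases Nat.eq_zero_or_pos m with rfl | hm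
      · simp [maxTerms_kPow_zero] at hir
      · exact hm
    rw [← ENNReal.ofReal_natCast, ← ENNReal.ofReal_inv_of_pos
      (by exact_mod_cast blockLength_pos δ i)]
    exact ENNReal.ofReal_le_ofReal (inv_blockLength_le hδ hk hm r
      ((le_mul_of_mem_maxTerms hir).trans (Nat.mul_le_mul_right _ l.2)))
  obtain ⟨ω, hω⟩ := hae.exists
  exact ⟨ω, fun l hl => hω ⟨l, hl⟩⟩

theorem stmt12 (k h : ℕ) (hk : 1 ≤ k) (hh2 : 2 ≤ h) (hhk : h ≤ k)
    (hyp : ∀ η : ℝ, 0 < η → ∃ n0 : ℕ, 1 ≤ n0 ∧ ∀ n : ℕ, n0 ≤ n →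
      (Rcnt (kPow k) h n : ℝ) < (n : ℝ) ^ η) :
    ∀ ε : ℝ, 0 < ε →
      ∃ A : Set ℕ, A ⊆ kPow k ∧ ∃ C : ℝ, 0 < C ∧ ∃ c : ℝ, 0 < c ∧
        (∀ n : ℕ, 1 ≤ n → (Rcnt A h n : ℝ) ≤ C) ∧
        ∃ x0 : ℝ, ∀ x : ℝ, x0 ≤ x →
          c * x ^ (1 / (k : ℝ) - ε) ≤ (countBelow A x : ℝ) := by
  intro ε hε
  have hk' : k ≠ 0 := by omega
  have hk0 : (0 : ℝ) < k := by exact_mod_cast hk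
  set δ : ℝ := k * ε with hδ
  have hδ0 : 0 < δ := by positivity
  obtain ⟨ω, hω⟩ := exists_choice_card_maxTerms_inter_le hδ0 hk' (.of_eventually hyp)
  have hsub : (Set.range fun i => blockPow δ k i (ω i)) ⊆ kPow k :=
    Set.range_subset_iff.2 fun i => blockPow_mem_kPow δ k i _
  obtain ⟨C, hC⟩ := exists_Rcnt_le_of_maxTerms hsub hω
  set γ : ℝ := 1 / (k * (1 + δ))
  have hγ : 1 / (k : ℝ) - ε ≤ γ := by
    rw [show γ = 1 / k * (1 / (1 + δ)) by simp only [γ]; field_simp,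
      show 1 / (k : ℝ) - ε = 1 / k * (1 - δ) by rw [hδ]; field_simp]
    gcongr
    rw [le_div_iff₀ (by positivity)]
    nlinarith
  refine ⟨_, hsub, C + 1, by positivity, ((4 : ℝ) ^ k) ^ (-γ) / 2, by positivity,
    fun n _ => (Nat.cast_le.2 (hC n)).trans (by simp), 4 ^ k, fun x hx => ?_⟩
  have hx1 : 1 ≤ x := (one_le_pow₀ (by norm_num)).trans hx
  refine le_trans ?_ (le_countBelow_range_blockPow hδ0.le hk' ω hx)
  calc ((4 : ℝ) ^ k) ^ (-γ) / 2 * x ^ (1 / (k : ℝ) - ε) ≤ ((4 : ℝ) ^ k) ^ (-γ) / 2 * x ^ γ := by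
        gcongr
    _ = (x / 4 ^ k) ^ γ / 2 := by
        rw [Real.div_rpow (by positivity) (by positivity), Real.rpow_neg (by positivity)]
        ring
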